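/- arXiv:2306.11909 — 2 statements merged into one kernel-verified Lean document; each statement's English description precedes it below -/
import Mathlib

section
/- With s(y) := Re(Λ(y)/(1+iy)) - π²N/12 and Λ(y) := N(π²/6 - log(2)²(1+iy)²/2 - Li₂(2^{-(1+iy)})), for every y₀ > 0 there exists d > 0 such that s(y) < -d for all y ∈ ℝ with |y| ≥ y₀. -/
open Real Complex

/-- Complex dilogarithm Li₂(w) = Σ_{n≥1} wⁿ/n² (for |w| < 1 the series converges). -/
noncomputable def Li2C (w : ℂ) : ℂ := ∑' n : ℕ, w ^ (n + 1) / ((n : ℂ) + 1) ^ 2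

/-- Λ(y) := N(π²/6 - log(2)²(1+iy)²/2 - Li₂(2^{-(1+iy)})). -/
noncomputable def Lam (N : ℕ) (y : ℝ) : ℂ :=
  (N : ℂ) * ((π : ℂ) ^ 2 / 6 - (Real.log 2 : ℂ) ^ 2 * (1 + (y : ℂ) * Complex.I) ^ 2 / 2 -
    Li2C ((2 : ℂ) ^ (-(1 + (y : ℂ) * Complex.I))))

/-- s(y) := Re(Λ(y)/(1+iy)) - π²N/12. -/
noncomputable def sfun (N : ℕ) (y : ℝ) : ℝ :=
  (Lam N y / (1 + (y : ℂ) * Complex.I)).re - π ^ 2 * N / 12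

/-- The terms `xⁿ/n²` (`n ≥ 1`) of the real dilogarithm series. -/
noncomputable def dilogTerm (n : ℕ) (x : ℝ) : ℝ := x ^ (n + 1) / ((n : ℝ) + 1) ^ 2

/-- The real dilogarithm `Li₂(x) = Σ_{n≥1} xⁿ/n²`. -/
noncomputable def dilog (x : ℝ) : ℝ := ∑' n : ℕ, dilogTerm n x

lemma hasSum_inv_succ_sq : HasSum (fun n : ℕ => 1 / ((n : ℝ) + 1) ^ 2) (π ^ 2 / 6) := by
  have h := (hasSum_nat_add_iff' (f := fun n : ℕ => 1 / (n : ℝ) ^ 2) 1).2 hasSum_zeta_two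
  simpa using h

lemma norm_dilogTerm_le (n : ℕ) {x : ℝ} (hx : x ∈ Set.Icc (0 : ℝ) 1) :
    ‖dilogTerm n x‖ ≤ 1 / ((n : ℝ) + 1) ^ 2 := by
  obtain ⟨h0, h1⟩ := hx
  rw [dilogTerm, Real.norm_of_nonneg (by positivity)]
  gcongr
  exact pow_le_one₀ h0 h1

lemma summable_dilogTerm {x : ℝ} (hx : x ∈ Set.Icc (0 : ℝ) 1) :
    Summable fun n => dilogTerm n x :=
  .of_norm_bounded hasSum_inv_succ_sq.summable fun n => norm_dilogTerm_le n hx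

lemma continuousOn_dilog : ContinuousOn dilog (Set.Icc 0 1) := by
  refine continuousOn_tsum (fun n => ?_) hasSum_inv_succ_sq.summable
    fun n x hx => norm_dilogTerm_le n hx
  unfold dilogTerm
  fun_prop

lemma dilog_zero : dilog 0 = 0 := by simp [dilog, dilogTerm]

lemma dilog_one : dilog 1 = π ^ 2 / 6 := by
  simpa [dilog, dilogTerm] using hasSum_inv_succ_sq.tsum_eq

lemma hasDerivAt_dilog {x : ℝ} (hx0 : 0 < x) (hx1 : x < 1) :
    HasDerivAt dilog (-Real.log (1 - x) / x) x := by
  obtain ⟨r, hxr, hr1⟩ := exists_between hx1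
  have hr0 : 0 < r := hx0.trans hxr
  have hder : HasDerivAt dilog (∑' n : ℕ, x ^ n / ((n : ℝ) + 1)) x := by
    refine hasDerivAt_tsum_of_isPreconnected (g := dilogTerm)
      (g' := fun n x => x ^ n / ((n : ℝ) + 1)) (t := Set.Ioo 0 r) (y₀ := x)
      (summable_geometric_of_lt_one hr0.le hr1) isOpen_Ioo isPreconnected_Ioo
      (fun n y _ => ?_) (fun n y hy => ?_) ⟨hx0, hxr⟩
      (summable_dilogTerm ⟨hx0.le, hx1.le⟩) ⟨hx0, hxr⟩
    · refine ((hasDerivAt_pow (n + 1) y).div_const (((n : ℝ) + 1) ^ 2)).congr_deriv ?_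
      rw [Nat.add_sub_cancel]
      push_cast
      field_simp
    · have := hy.1
      rw [Real.norm_of_nonneg (by positivity)]
      calc y ^ n / ((n : ℝ) + 1) ≤ y ^ n := div_le_self (by positivity) (by simp)
        _ ≤ r ^ n := pow_le_pow_left₀ hy.1.le hy.2.le n
  have hsum : HasSum (fun n : ℕ => x ^ n / ((n : ℝ) + 1)) (-Real.log (1 - x) / x) := by
    have h := Real.hasSum_pow_div_log_of_abs_lt_one (x := x) (by rwa [abs_of_pos hx0])
    refine (h.div_const x).congr_fun fun n => ?_
    field_simp
    ring
  rwa [hsum.tsum_eq] at hder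

lemma tendsto_log_mul_log_one_sub :
    Filter.Tendsto (fun x : ℝ => Real.log x * Real.log (1 - x)) (nhdsWithin 0 (Set.Ioi 0))
      (nhds 0) := by
  have h1 : Filter.Tendsto (fun x : ℝ => x * Real.log x) (nhdsWithin 0 (Set.Ioi 0)) (nhds 0) := by
    simpa using (Real.continuous_mul_log.tendsto 0).mono_left nhdsWithin_le_nhds
  have h2 : HasDerivAt (fun x : ℝ => Real.log (1 - x)) (-1) 0 := by
    simpa using ((hasDerivAt_id (0 : ℝ)).const_sub 1).log (by simp)
  have h3 := h2.tendsto_slope.mono_left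
    (nhdsWithin_mono 0 fun x (hx : x ∈ Set.Ioi (0 : ℝ)) => ne_of_gt hx)
  have h4 := h1.mul h3
  rw [zero_mul] at h4
  refine h4.congr' ?_
  filter_upwards [self_mem_nhdsWithin] with x hx
  have hx' : x ≠ 0 := ne_of_gt hx
  simp only [slope_def_field, sub_zero, Real.log_one]
  field_simp

/-- Euler's reflection formula for the dilogarithm. -/
theorem dilog_add_dilog_one_sub {x : ℝ} (hx0 : 0 < x) (hx1 : x < 1) :
    dilog x + dilog (1 - x) + Real.log x * Real.log (1 - x) = π ^ 2 / 6 := by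
  set F : ℝ → ℝ := fun x => dilog x + dilog (1 - x) + Real.log x * Real.log (1 - x)
  have hder : ∀ y ∈ Set.Ioo (0 : ℝ) 1, HasDerivAt F 0 y := by
    rintro y ⟨hy0, hy1⟩
    have hy : 0 < 1 - y := by linarith
    have hsub : HasDerivAt (fun y : ℝ => 1 - y) (-1) y := (hasDerivAt_id y).const_sub 1
    have hdil : HasDerivAt (fun y : ℝ => dilog (1 - y)) _ y :=
      (hasDerivAt_dilog hy (by linarith)).comp y hsub
    refine (((hasDerivAt_dilog hy0 hy1).add hdil).add
      ((Real.hasDerivAt_log hy0.ne').mul (hsub.log hy.ne'))).congr_deriv ?_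
    rw [sub_sub_cancel]
    field_simp
    ring
  have hconst : ∀ y ∈ Set.Ioo (0 : ℝ) 1, F y = F x := fun y hy =>
    isOpen_Ioo.is_const_of_deriv_eq_zero isPreconnected_Ioo
      (fun z hz => (hder z hz).differentiableAt.differentiableWithinAt)
      (fun z hz => (hder z hz).deriv) hy ⟨hx0, hx1⟩
  have hmem : Set.Ioo (0 : ℝ) 1 ∈ nhdsWithin (0 : ℝ) (Set.Ioi 0) :=
    Ioo_mem_nhdsGT one_pos
  have hid : Filter.Tendsto (fun y : ℝ => y) (nhdsWithin 0 (Set.Ioi 0))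
      (nhdsWithin 0 (Set.Icc 0 1)) :=
    tendsto_nhdsWithin_iff.2 ⟨Filter.tendsto_id.mono_right nhdsWithin_le_nhds,
      Filter.mem_of_superset hmem fun y hy => ⟨hy.1.le, hy.2.le⟩⟩
  have hsub : Filter.Tendsto (fun y : ℝ => 1 - y) (nhdsWithin 0 (Set.Ioi 0))
      (nhdsWithin 1 (Set.Icc 0 1)) := by
    refine tendsto_nhdsWithin_iff.2 ⟨?_, Filter.mem_of_superset hmem fun y hy => ?_⟩
    · have : Continuous fun y : ℝ => 1 - y := by fun_prop
      simpa using (this.tendsto 0).mono_left nhdsWithin_le_nhds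
    · exact ⟨by linarith [hy.2], by linarith [hy.1]⟩
  have hlim : Filter.Tendsto F (nhdsWithin 0 (Set.Ioi 0)) (nhds (0 + π ^ 2 / 6 + 0)) := by
    refine Filter.Tendsto.add (.add ?_ ?_) tendsto_log_mul_log_one_sub
    · have h := (continuousOn_dilog 0 (by simp)).tendsto.comp hid
      rwa [dilog_zero] at h
    · have h := (continuousOn_dilog 1 (by simp)).tendsto.comp hsub
      rwa [dilog_one] at h
  have hlim' : Filter.Tendsto F (nhdsWithin 0 (Set.Ioi 0)) (nhds (F x)) :=
    tendsto_const_nhds.congr' (Filter.mem_of_superset hmem fun y hy => (hconst y hy).symm)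
  simpa using tendsto_nhds_unique hlim' hlim

lemma dilog_one_half : dilog (1 / 2) = π ^ 2 / 12 - Real.log 2 ^ 2 / 2 := by
  have h := dilog_add_dilog_one_sub (x := 1 / 2) (by norm_num) (by norm_num)
  have hlog : Real.log (1 / 2) = -Real.log 2 := by rw [one_div, Real.log_inv]
  rw [show (1 : ℝ) - 1 / 2 = 1 / 2 by norm_num, hlog] at h
  linarith

lemma two_cpow_neg (y : ℝ) :
    (2 : ℂ) ^ (-(1 + (y : ℂ) * Complex.I)) =
      (1 / 2 : ℝ) * Complex.exp ((-(y * Real.log 2) : ℝ) * Complex.I) := by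
  have h : Complex.log 2 = (Real.log 2 : ℂ) := by
    rw [Complex.ofReal_log (by norm_num)]; simp
  rw [Complex.cpow_def_of_ne_zero two_ne_zero,
    show Complex.log 2 * -(1 + (y : ℂ) * Complex.I) =
      -Complex.log 2 + (-(y * Real.log 2) : ℝ) * Complex.I by rw [h]; push_cast; ring,
    Complex.exp_add, Complex.exp_neg, Complex.exp_log two_ne_zero]
  simp

lemma hasSum_geometric_half : HasSum (fun n : ℕ => (1 / 2 : ℝ) ^ (n + 1)) 1 := by
  have h := hasSum_geometric_two.mul_right (1 / 2 : ℝ)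
  rw [mul_one_div_cancel two_ne_zero] at h
  simpa only [pow_succ] using h

/-- The terms of `Li₂(e^{iφ}/2)` in polar form. -/
lemma Li2C_term_polar (n : ℕ) (φ : ℝ) :
    (((1 / 2 : ℝ) : ℂ) * Complex.exp (φ * Complex.I)) ^ (n + 1) / ((n : ℂ) + 1) ^ 2 =
      (dilogTerm n (1 / 2) : ℂ) * Complex.exp (((n + 1) * φ : ℝ) * Complex.I) := by
  rw [mul_pow, ← Complex.exp_nat_mul, dilogTerm]
  push_cast
  rw [mul_assoc ((n : ℂ) + 1)]
  ring

lemma hasSum_Li2C_polar (φ : ℝ) :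
    HasSum (fun n : ℕ => (dilogTerm n (1 / 2) : ℂ) *
        Complex.exp (((n + 1) * φ : ℝ) * Complex.I))
      (Li2C ((1 / 2 : ℝ) * Complex.exp (φ * Complex.I))) := by
  rw [Li2C]
  simp only [Li2C_term_polar]
  refine Summable.hasSum (.of_norm ?_)
  simp only [norm_mul, Complex.norm_exp_ofReal_mul_I, mul_one, Complex.norm_real]
  exact (summable_dilogTerm ⟨by norm_num, by norm_num⟩).norm

lemma dilog_half_sub_re_Li2C_le (φ : ℝ) :
    dilog (1 / 2) - (Li2C ((1 / 2 : ℝ) * Complex.exp (φ * Complex.I))).re ≤ φ ^ 2 / 2 := by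
  have hre := Complex.hasSum_re (hasSum_Li2C_polar φ)
  have hsum := (summable_dilogTerm (x := 1 / 2) ⟨by norm_num, by norm_num⟩).hasSum.sub hre
  have hbound := hasSum_geometric_half.mul_right (φ ^ 2 / 2)
  rw [one_mul] at hbound
  refine hasSum_le (fun n => ?_) hsum hbound
  rw [Complex.re_ofReal_mul, Complex.exp_ofReal_mul_I_re, dilogTerm]
  have hcos := Real.one_sub_sq_div_two_le_cos (x := (n + 1) * φ)
  calc _ = (1 / 2 : ℝ) ^ (n + 1) / ((n : ℝ) + 1) ^ 2 * (1 - Real.cos ((n + 1) * φ)) := by ring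
    _ ≤ (1 / 2 : ℝ) ^ (n + 1) / ((n : ℝ) + 1) ^ 2 * (((n + 1) * φ) ^ 2 / 2) := by
        gcongr; linarith
    _ = _ := by field_simp

lemma abs_im_Li2C_le (φ : ℝ) :
    |(Li2C ((1 / 2 : ℝ) * Complex.exp (φ * Complex.I))).im| ≤ |φ| * Real.log 2 := by
  have him := Complex.hasSum_im (hasSum_Li2C_polar φ)
  have hlog := Real.hasSum_pow_div_log_of_abs_lt_one (x := 1 / 2) (by norm_num [abs_lt])
  rw [show (1 : ℝ) - 1 / 2 = 2⁻¹ by norm_num, Real.log_inv, neg_neg] at hlog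
  rw [← Real.norm_eq_abs, ← him.tsum_eq]
  refine tsum_of_norm_bounded (hlog.mul_left |φ|) fun n => ?_
  rw [Complex.im_ofReal_mul, Complex.exp_ofReal_mul_I_im, dilogTerm, norm_mul,
    Real.norm_of_nonneg (by positivity), Real.norm_eq_abs]
  have hn : |(n : ℝ) + 1| = n + 1 := abs_of_nonneg (by positivity)
  calc _ ≤ (1 / 2 : ℝ) ^ (n + 1) / ((n : ℝ) + 1) ^ 2 * |(n + 1) * φ| := by
        exact mul_le_mul_of_nonneg_left Real.abs_sin_le_abs (by positivity)
    _ = _ := by rw [abs_mul, hn]; field_simp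

lemma sfun_eq (N : ℕ) (y : ℝ) :
    sfun N y = N * (π ^ 2 / 6 - Real.log 2 ^ 2 / 2 * (1 + y ^ 2) - π ^ 2 / 12 * (1 + y ^ 2)
      - (Li2C ((2 : ℂ) ^ (-(1 + (y : ℂ) * Complex.I)))).re
      - y * (Li2C ((2 : ℂ) ^ (-(1 + (y : ℂ) * Complex.I)))).im) / (1 + y ^ 2) := by
  have hy : (1 + y ^ 2 : ℝ) ≠ 0 := by positivity
  have hnorm : Complex.normSq (1 + (y : ℂ) * Complex.I) = 1 + y ^ 2 := by
    simp [Complex.normSq_apply]; ring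
  rw [sfun, Lam]
  generalize Li2C ((2 : ℂ) ^ (-(1 + (y : ℂ) * Complex.I))) = Z
  have hcast : (π : ℂ) ^ 2 / 6 = ((π ^ 2 / 6 : ℝ) : ℂ) := by push_cast; rfl
  have hsq : (Real.log 2 : ℂ) ^ 2 * (1 + (y : ℂ) * Complex.I) ^ 2 / 2 =
      ((Real.log 2 ^ 2 / 2 * (1 - y ^ 2) : ℝ) : ℂ) +
        ((Real.log 2 ^ 2 * y : ℝ) : ℂ) * Complex.I := by
    push_cast
    linear_combination ((Real.log 2 : ℂ) ^ 2 * (y : ℂ) ^ 2 / 2) * Complex.I_sq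
  rw [hcast, hsq, Complex.div_re, hnorm]
  simp only [Complex.mul_re, Complex.mul_im, Complex.sub_re, Complex.sub_im, Complex.add_re,
    Complex.add_im, Complex.ofReal_re, Complex.ofReal_im, Complex.natCast_re, Complex.natCast_im,
    Complex.I_re, Complex.I_im, Complex.one_re, Complex.one_im]
  field_simp
  ring

lemma sfun_le (N : ℕ) (y : ℝ) :
    sfun N y ≤ -(N * (π ^ 2 / 12 - Real.log 2 ^ 2) * (y ^ 2 / (1 + y ^ 2))) := by
  have hre := dilog_half_sub_re_Li2C_le (-(y * Real.log 2))
  have him := abs_im_Li2C_le (-(y * Real.log 2))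
  rw [← two_cpow_neg, dilog_one_half] at hre
  rw [← two_cpow_neg, abs_neg, abs_mul, abs_of_pos (Real.log_pos one_lt_two)] at him
  rw [sfun_eq, ← mul_div_assoc, ← neg_div, mul_assoc, ← mul_neg]
  generalize Li2C ((2 : ℂ) ^ (-(1 + (y : ℂ) * Complex.I))) = Z at *
  have hyim : -(y * Z.im) ≤ y ^ 2 * Real.log 2 ^ 2 :=
    calc -(y * Z.im) ≤ |y| * |Z.im| := by rw [← abs_mul]; exact neg_le_abs _
      _ ≤ |y| * (|y| * Real.log 2 * Real.log 2) := by gcongr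
      _ = y ^ 2 * Real.log 2 ^ 2 := by rw [← sq_abs y]; ring
  gcongr
  linarith

lemma log_two_sq_lt : Real.log 2 ^ 2 < π ^ 2 / 12 := by
  nlinarith [Real.pi_gt_three, Real.log_two_lt_d9, Real.log_pos one_lt_two]

/-- For every y₀ > 0 there exists d > 0 with s(y) < -d whenever |y| ≥ y₀. -/
theorem sfun_neg_away_from_zero (N : ℕ) (hN : 0 < N) (y₀ : ℝ) (hy₀ : 0 < y₀) :
    ∃ d > 0, ∀ y : ℝ, y₀ ≤ |y| → sfun N y < -d := by
  have hc : 0 < N * (π ^ 2 / 12 - Real.log 2 ^ 2) :=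
    mul_pos (by exact_mod_cast hN) (sub_pos.2 log_two_sq_lt)
  set m := N * (π ^ 2 / 12 - Real.log 2 ^ 2) * (y₀ ^ 2 / (1 + y₀ ^ 2))
  have hm : 0 < m := by positivity
  refine ⟨m / 2, half_pos hm, fun y hy => ?_⟩
  have hsq : y₀ ^ 2 ≤ y ^ 2 := by
    rw [← sq_abs y]
    gcongr
  have hfrac : y₀ ^ 2 / (1 + y₀ ^ 2) ≤ y ^ 2 / (1 + y ^ 2) := by
    rw [div_le_div_iff₀ (by positivity) (by positivity)]
    linarith
  have hle : m ≤ N * (π ^ 2 / 12 - Real.log 2 ^ 2) * (y ^ 2 / (1 + y ^ 2)) :=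
    mul_le_mul_of_nonneg_left hfrac hc.le
  linarith [sfun_le N y]
end

section
/- Let A ≥ 0, B > 0, θ > 0 be fixed reals. For n ∈ ℕ let C₁(B/√n) := { z = (B/√n)(1+iy) : |y| ≤ θ }. Then for every R ∈ ℕ, as n → ∞, (1/2πi)∫_{C₁(B/√n)} z^A e^{B²/z + nz} dz = n^{(-2A-3)/4} e^{2B√n} ( Σ_{r=0}^{R-1} T_{A,B,r} n^{-r/2} + O(n^{-R/2}) ), where T_{A,B,r} := (-4B)^{-r} B^{A+1/2} Γ(A+r+3/2) / (2√π · r! · Γ(A-r+3/2)). -/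
open Real Complex Filter intervalIntegral

/-- T_{A,B,r} := (-4B)^{-r} B^{A+1/2} Γ(A+r+3/2) / (2√π · r! · Γ(A-r+3/2)). -/
noncomputable def Tcoef (A B : ℝ) (r : ℕ) : ℝ :=
  (-4 * B) ^ (-(r : ℤ)) * B ^ (A + 1 / 2) * Real.Gamma (A + r + 3 / 2) /
    (2 * Real.sqrt π * (r.factorial : ℝ) * Real.Gamma (A - r + 3 / 2))

/-- The contour integral (1/2πi)∫_{C₁(B/√n)} z^A e^{B²/z+nz} dz, where
C₁(η) = {η(1+iy) : |y| ≤ θ} is parametrized by y (dz = iη dy), so that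
(1/2πi)∫ = (η/2π)∫_{-θ}^{θ} z(y)^A e^{B²/z(y)+nz(y)} dy with z(y) = η(1+iy). -/
noncomputable def saddleIntegral (A B θ : ℝ) (n : ℕ) : ℂ :=
  ((B / Real.sqrt n) / (2 * π) : ℝ) *
    ∫ y in (-θ)..θ,
      (((B / Real.sqrt n : ℝ) : ℂ) * (1 + (y : ℂ) * Complex.I)) ^ (A : ℂ) *
        Complex.exp (((B : ℂ) ^ 2) / (((B / Real.sqrt n : ℝ) : ℂ) * (1 + (y : ℂ) * Complex.I)) +
          (n : ℂ) * (((B / Real.sqrt n : ℝ) : ℂ) * (1 + (y : ℂ) * Complex.I)))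

/-- Coefficients of the expansion of `cos (2 ν u)` as `cos u` times a power series in `sin u ^ 2`. -/
noncomputable def cosCoeff (ν : ℝ) : ℕ → ℝ
  | 0 => 1
  | k + 1 => cosCoeff ν k * ((2 * k + 1) ^ 2 - 4 * ν ^ 2) / ((2 * k + 2) * (2 * k + 1))

/-- The remainder of the expansion of `cos (2 ν u)` after `m` terms. -/
noncomputable def cosRemainder (ν : ℝ) (m : ℕ) (u : ℝ) : ℝ :=
  Real.cos (2 * ν * u) -
    ∑ k ∈ Finset.range m, cosCoeff ν k * (Real.cos u * Real.sin u ^ (2 * k))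

lemma cosRemainder_succ (ν : ℝ) (m : ℕ) (u : ℝ) :
    cosRemainder ν (m + 1) u =
      cosRemainder ν m u - cosCoeff ν m * (Real.cos u * Real.sin u ^ (2 * m)) := by
  simp only [cosRemainder, Finset.sum_range_succ]
  ring

lemma cosCoeff_succ_mul (ν : ℝ) (k : ℕ) :
    cosCoeff ν (k + 1) * ((2 * k + 2) * (2 * k + 1)) =
      cosCoeff ν k * ((2 * k + 1) ^ 2 - 4 * ν ^ 2) := by
  rw [cosCoeff]
  field_simp

lemma abs_le_mul_abs_pow_succ_of_hasDerivAt {f f' : ℝ → ℝ} {K : ℝ} {p : ℕ}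
    (hf : ∀ u, HasDerivAt f (f' u) u) (h0 : f 0 = 0) (hb : ∀ u, |f' u| ≤ K * |u| ^ p) (u : ℝ) :
    |f u| ≤ K * |u| ^ (p + 1) := by
  have hK : 0 ≤ K := by simpa using (abs_nonneg _).trans (hb 1)
  have := (convex_Icc (-|u|) |u|).norm_image_sub_le_of_norm_hasDerivWithin_le
    (f := f) (f' := f') (C := K * |u| ^ p) (x := 0) (y := u)
    (fun x _ => (hf x).hasDerivWithinAt)
    (fun x hx => (hb x).trans (by
      have := abs_le.2 hx
      gcongr))
    (by simp) ⟨neg_abs_le u, le_abs_self u⟩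
  simpa [h0, pow_succ, mul_assoc] using this

lemma hasDerivAt_cos_mul_sin_pow (k : ℕ) (u : ℝ) :
    HasDerivAt (fun u => Real.cos u * Real.sin u ^ (2 * k))
      (2 * k * Real.sin u ^ (2 * k - 1) - (2 * k + 1) * Real.sin u ^ (2 * k + 1)) u := by
  refine ((Real.hasDerivAt_cos u).mul ((Real.hasDerivAt_sin u).pow (2 * k))).congr_deriv ?_
  have h : Real.cos u * Real.cos u = 1 - Real.sin u ^ 2 := by rw [← Real.cos_sq', sq]
  rcases k with _ | k
  · simp
  · rw [show 2 * (k + 1) - 1 = 2 * k + 1 by omega]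
    simp only [Pi.pow_apply]
    push_cast
    linear_combination (2 * (k + 1) * Real.sin u ^ (2 * k + 1)) * h

lemma hasDerivAt_deriv_cos_mul_sin_pow (k : ℕ) (u : ℝ) :
    HasDerivAt
      (fun u => 2 * k * Real.sin u ^ (2 * k - 1) - (2 * k + 1) * Real.sin u ^ (2 * k + 1))
      (Real.cos u * (2 * k * (2 * k - 1) * Real.sin u ^ (2 * k - 2) -
        (2 * k + 1) ^ 2 * Real.sin u ^ (2 * k))) u := by
  refine ((((Real.hasDerivAt_sin u).pow (2 * k - 1)).const_mul (2 * (k : ℝ))).sub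
    (((Real.hasDerivAt_sin u).pow (2 * k + 1)).const_mul (2 * (k : ℝ) + 1))).congr_deriv ?_
  rcases k with _ | k
  · simp
  · rw [show 2 * (k + 1) - 1 = 2 * k + 1 by omega, show 2 * (k + 1) - 2 = 2 * k by omega]
    push_cast
    ring

lemma cosRemainder_ode (ν : ℝ) (m : ℕ) :
    cosRemainder ν m 0 = (if m = 0 then 1 else 0) ∧
    ∃ f' : ℝ → ℝ, f' 0 = 0 ∧ (∀ u, HasDerivAt (cosRemainder ν m) (f' u) u) ∧
      ∀ u, HasDerivAt f' (-(4 * ν ^ 2) * cosRemainder ν m u +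
        2 * m * (2 * m - 1) * cosCoeff ν m * (Real.cos u * Real.sin u ^ (2 * m - 2))) u := by
  induction m with
  | zero =>
    refine ⟨by simp [cosRemainder], fun u => -Real.sin (2 * ν * u) * (2 * ν), by simp, ?_, ?_⟩
    · intro u
      have : cosRemainder ν 0 = fun u => Real.cos (2 * ν * u) := by
        ext; simp [cosRemainder]
      rw [this]
      simpa using (((hasDerivAt_id u).const_mul (2 * ν))).cos
    · intro u
      have := (((((hasDerivAt_id u).const_mul (2 * ν))).sin).neg).mul_const (2 * ν)
      refine this.congr_deriv ?_
      simp [cosRemainder]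
      ring
  | succ m ih =>
    obtain ⟨h0, f', hf0, hf, hf'⟩ := ih
    refine ⟨?_, fun u => f' u - cosCoeff ν m *
      (2 * m * Real.sin u ^ (2 * m - 1) - (2 * m + 1) * Real.sin u ^ (2 * m + 1)), ?_, ?_, ?_⟩
    · rw [cosRemainder_succ, h0]
      rcases m with _ | m <;> simp [cosCoeff]
    · rcases m with _ | m
      · simp [hf0]
      · simp [hf0, show 2 * (m + 1) - 1 = 2 * m + 1 by omega]
    · intro u
      rw [show cosRemainder ν (m + 1) = fun u => cosRemainder ν m u -
        cosCoeff ν m * (Real.cos u * Real.sin u ^ (2 * m)) from funext (cosRemainder_succ ν m)]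
      exact (hf u).sub ((hasDerivAt_cos_mul_sin_pow m u).const_mul _)
    · intro u
      refine ((hf' u).sub ((hasDerivAt_deriv_cos_mul_sin_pow m u).const_mul _)).congr_deriv ?_
      rw [cosRemainder_succ, show 2 * (m + 1) - 2 = 2 * m by omega]
      push_cast
      linear_combination -(Real.cos u * Real.sin u ^ (2 * m)) * cosCoeff_succ_mul ν m

lemma exists_abs_cosRemainder_le (ν : ℝ) (m : ℕ) :
    ∃ C, ∀ u, |cosRemainder ν m u| ≤ C * |u| ^ (2 * m) := by
  induction m with
  | zero => exact ⟨1, fun u => by simpa [cosRemainder] using Real.abs_cos_le_one _⟩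
  | succ m ih =>
    obtain ⟨C, hC⟩ := ih
    obtain ⟨h0, f', hf0, hf, hf'⟩ := cosRemainder_ode ν (m + 1)
    have hterm (u : ℝ) : |Real.cos u * Real.sin u ^ (2 * m)| ≤ |u| ^ (2 * m) := by
      rw [abs_mul, abs_pow]
      exact (mul_le_of_le_one_left (by positivity) (Real.abs_cos_le_one u)).trans
        (pow_le_pow_left₀ (abs_nonneg _) Real.abs_sin_le_abs _)
    set D := 2 * ((m + 1 : ℕ) : ℝ) * (2 * ((m + 1 : ℕ) : ℝ) - 1) * cosCoeff ν (m + 1)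
    refine ⟨4 * ν ^ 2 * (C + |cosCoeff ν m|) + |D|, fun u => ?_⟩
    refine abs_le_mul_abs_pow_succ_of_hasDerivAt hf (by simpa using h0)
      (abs_le_mul_abs_pow_succ_of_hasDerivAt hf' hf0 fun u => ?_) u
    rw [show 2 * (m + 1) - 2 = 2 * m by omega]
    have h1 : |cosRemainder ν (m + 1) u| ≤ (C + |cosCoeff ν m|) * |u| ^ (2 * m) := by
      rw [cosRemainder_succ, add_mul]
      refine (abs_sub _ _).trans (add_le_add (hC u) ?_)
      rw [abs_mul]
      gcongr
      exact hterm u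
    calc |-(4 * ν ^ 2) * cosRemainder ν (m + 1) u + D * (Real.cos u * Real.sin u ^ (2 * m))|
      _ ≤ |(-(4 * ν ^ 2) * cosRemainder ν (m + 1) u)| +
          |D * (Real.cos u * Real.sin u ^ (2 * m))| := abs_add_le _ _
      _ = 4 * ν ^ 2 * |cosRemainder ν (m + 1) u| +
          |D| * |Real.cos u * Real.sin u ^ (2 * m)| := by
        rw [abs_mul, abs_mul, abs_neg, abs_of_nonneg (by positivity : 0 ≤ 4 * ν ^ 2)]
      _ ≤ 4 * ν ^ 2 * ((C + |cosCoeff ν m|) * |u| ^ (2 * m)) + |D| * |u| ^ (2 * m) := by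
        gcongr
        exact hterm u
      _ = (4 * ν ^ 2 * (C + |cosCoeff ν m|) + |D|) * |u| ^ (2 * m) := by ring

lemma integral_Ioi_pow_mul_exp_neg_mul_sq (k : ℕ) {μ : ℝ} (hμ : 0 < μ) :
    ∫ t in Set.Ioi (0 : ℝ), t ^ (2 * k) * Real.exp (-μ * t ^ 2) =
      Real.Gamma (k + 1 / 2) / 2 * μ ^ (-((k : ℝ) + 1 / 2)) := by
  have := integral_rpow_mul_exp_neg_mul_rpow (p := 2) (q := (2 * k : ℕ)) (b := μ) two_pos
    (by linarith [(2 * k : ℕ).cast_nonneg (α := ℝ)]) hμ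
  simp only [Real.rpow_natCast, Real.rpow_two] at this
  rw [this, show (((2 * k : ℕ) : ℝ) + 1) / 2 = k + 1 / 2 by push_cast; ring,
    show -(((2 * k : ℕ) : ℝ) + 1) / 2 = -((k : ℝ) + 1 / 2) by push_cast; ring]
  ring

lemma integrableOn_Ioi_pow_mul_exp_neg_mul_sq (k : ℕ) {μ : ℝ} (hμ : 0 < μ) :
    MeasureTheory.IntegrableOn (fun t : ℝ => t ^ (2 * k) * Real.exp (-μ * t ^ 2))
      (Set.Ioi 0) := by
  have := integrableOn_rpow_mul_exp_neg_mul_sq hμ (s := (2 * k : ℕ))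
    (by linarith [(2 * k : ℕ).cast_nonneg (α := ℝ)])
  simpa only [Real.rpow_natCast] using this

lemma intervalIntegral_pow_mul_exp_le (k : ℕ) {μ s : ℝ} (hμ : 0 < μ) (hs : 0 ≤ s) :
    ∫ t in (0 : ℝ)..s, t ^ (2 * k) * Real.exp (-μ * t ^ 2) ≤
      Real.Gamma (k + 1 / 2) / 2 * μ ^ (-((k : ℝ) + 1 / 2)) := by
  rw [← integral_Ioi_pow_mul_exp_neg_mul_sq k hμ, intervalIntegral.integral_of_le hs]
  refine MeasureTheory.setIntegral_mono_set (integrableOn_Ioi_pow_mul_exp_neg_mul_sq k hμ) ?_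
    Set.Ioc_subset_Ioi_self.eventuallyLE
  exact Eventually.of_forall fun t => mul_nonneg ((even_two_mul k).pow_nonneg t) (Real.exp_nonneg _)

lemma isBigO_exp_neg_mul_rpow {c : ℝ} (hc : 0 < c) (b : ℝ) :
    (fun x : ℝ => Real.exp (-c * x)) =O[atTop] fun x => x ^ b :=
  (isLittleO_exp_neg_mul_rpow_atTop hc b).isBigO

lemma intervalIntegral_pow_mul_exp_isBigO (k : ℕ) {s : ℝ} (hs : 0 < s) (b : ℝ) :
    (fun μ => (∫ t in (0 : ℝ)..s, t ^ (2 * k) * Real.exp (-μ * t ^ 2)) -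
      Real.Gamma (k + 1 / 2) / 2 * μ ^ (-((k : ℝ) + 1 / 2))) =O[atTop] fun μ : ℝ => μ ^ b := by
  refine Asymptotics.IsBigO.trans ?_ (isBigO_exp_neg_mul_rpow (c := s ^ 2 / 2) (by positivity) b)
  refine Asymptotics.IsBigO.of_bound (Real.Gamma (k + 1 / 2) / 2) ?_
  filter_upwards [eventually_ge_atTop 2] with μ hμ
  have hμ0 : 0 < μ := by linarith
  have hint := integrableOn_Ioi_pow_mul_exp_neg_mul_sq k hμ0
  have hint2 := integrableOn_Ioi_pow_mul_exp_neg_mul_sq k (half_pos hμ0)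
  have hsub := Set.Ioi_subset_Ioi hs.le
  have hnn (c t : ℝ) : 0 ≤ t ^ (2 * k) * Real.exp (-c * t ^ 2) :=
    mul_nonneg ((even_two_mul k).pow_nonneg t) (Real.exp_nonneg _)
  rw [← integral_Ioi_pow_mul_exp_neg_mul_sq k hμ0,
    ← intervalIntegral.integral_interval_add_Ioi hint (hint.mono_set hsub), sub_add_cancel_left,
    norm_neg, Real.norm_of_nonneg (MeasureTheory.setIntegral_nonneg measurableSet_Ioi
      fun t _ => hnn μ t), Real.norm_of_nonneg (Real.exp_nonneg _)]
  calc _ ≤ ∫ t in Set.Ioi s, Real.exp (-(s ^ 2 / 2) * μ) *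
        (t ^ (2 * k) * Real.exp (-(μ / 2) * t ^ 2)) := by
        refine MeasureTheory.setIntegral_mono_on (hint.mono_set hsub)
          ((hint2.mono_set hsub).const_mul _) measurableSet_Ioi fun t ht => ?_
        have h1 : s ^ 2 ≤ t ^ 2 := pow_le_pow_left₀ hs.le (le_of_lt ht) 2
        rw [mul_left_comm, ← Real.exp_add]
        refine mul_le_mul_of_nonneg_left (Real.exp_le_exp.2 ?_) ((even_two_mul k).pow_nonneg t)
        nlinarith
    _ = Real.exp (-(s ^ 2 / 2) * μ) *
        ∫ t in Set.Ioi s, t ^ (2 * k) * Real.exp (-(μ / 2) * t ^ 2) :=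
        MeasureTheory.integral_const_mul _ _
    _ ≤ Real.exp (-(s ^ 2 / 2) * μ) *
        ∫ t in Set.Ioi 0, t ^ (2 * k) * Real.exp (-(μ / 2) * t ^ 2) := by
        refine mul_le_mul_of_nonneg_left ?_ (Real.exp_nonneg _)
        exact MeasureTheory.setIntegral_mono_set hint2 (Eventually.of_forall fun t => hnn _ t)
          hsub.eventuallyLE
    _ = Real.exp (-(s ^ 2 / 2) * μ) *
        (Real.Gamma (k + 1 / 2) / 2 * (μ / 2) ^ (-((k : ℝ) + 1 / 2))) := by
        rw [integral_Ioi_pow_mul_exp_neg_mul_sq k (half_pos hμ0)]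
    _ ≤ Real.exp (-(s ^ 2 / 2) * μ) * (Real.Gamma (k + 1 / 2) / 2 * 1) := by
        have hG : 0 < Real.Gamma (k + 1 / 2) := Real.Gamma_pos_of_pos (by positivity)
        gcongr
        exact Real.rpow_le_one_of_one_le_of_nonpos (by linarith)
          (by linarith [k.cast_nonneg (α := ℝ)])
    _ = _ := by ring

lemma integral_cos_mul_sin_pow_mul_exp (k : ℕ) (μ a : ℝ) :
    ∫ u in (0 : ℝ)..a, Real.cos u * Real.sin u ^ (2 * k) * Real.exp (-μ * Real.sin u ^ 2) =
      ∫ t in (0 : ℝ)..Real.sin a, t ^ (2 * k) * Real.exp (-μ * t ^ 2) := by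
  have := intervalIntegral.integral_comp_mul_deriv (a := 0) (b := a)
    (g := fun t => t ^ (2 * k) * Real.exp (-μ * t ^ 2))
    (fun u _ => Real.hasDerivAt_sin u) Real.continuous_cos.continuousOn (by fun_prop)
  rw [Real.sin_zero] at this
  rw [← this]
  refine intervalIntegral.integral_congr fun u _ => ?_
  simp only [Function.comp_apply]
  ring

lemma integral_cos_mul_exp_neg_sin_sq_isBigO (ν : ℝ) {a : ℝ} (ha : 0 < a) (ha' : a < π / 2)
    (R : ℕ) :
    (fun μ => (∫ u in (0 : ℝ)..a, Real.cos (2 * ν * u) * Real.exp (-μ * Real.sin u ^ 2)) -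
      ∑ k ∈ Finset.range R, cosCoeff ν k *
        (Real.Gamma (k + 1 / 2) / 2 * μ ^ (-((k : ℝ) + 1 / 2)))) =O[atTop]
      fun μ : ℝ => μ ^ (-((R : ℝ) + 1 / 2)) := by
  obtain ⟨C, hC⟩ := exists_abs_cosRemainder_le ν R
  have hs : 0 < Real.sin a := Real.sin_pos_of_pos_of_lt_pi ha (by linarith)
  have hca : 0 < Real.cos a := Real.cos_pos_of_mem_Ioo ⟨by linarith, ha'⟩
  have hC0 : 0 ≤ C := by simpa using (abs_nonneg _).trans (hC 1)
  have hsplit (μ : ℝ) :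
      (∫ u in (0 : ℝ)..a, Real.cos (2 * ν * u) * Real.exp (-μ * Real.sin u ^ 2)) -
        ∑ k ∈ Finset.range R, cosCoeff ν k *
          (Real.Gamma (k + 1 / 2) / 2 * μ ^ (-((k : ℝ) + 1 / 2))) =
      (∫ u in (0 : ℝ)..a, cosRemainder ν R u * Real.exp (-μ * Real.sin u ^ 2)) +
        ∑ k ∈ Finset.range R, cosCoeff ν k *
          ((∫ t in (0 : ℝ)..Real.sin a, t ^ (2 * k) * Real.exp (-μ * t ^ 2)) -
            Real.Gamma (k + 1 / 2) / 2 * μ ^ (-((k : ℝ) + 1 / 2))) := by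
    simp only [mul_sub, Finset.sum_sub_distrib, ← integral_cos_mul_sin_pow_mul_exp,
      ← intervalIntegral.integral_const_mul]
    rw [← intervalIntegral.integral_finsetSum
      (fun k _ => Continuous.intervalIntegrable (by fun_prop) _ _), ← add_sub_assoc,
      ← intervalIntegral.integral_add (Continuous.intervalIntegrable
        (by unfold cosRemainder; fun_prop) _ _)
        (Continuous.intervalIntegrable (by fun_prop) _ _)]
    congr 1
    refine intervalIntegral.integral_congr fun u _ => ?_
    simp only [cosRemainder, sub_mul, Finset.sum_mul, mul_assoc, sub_add_cancel]
  simp only [hsplit]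
  refine Asymptotics.IsBigO.add ?_ (Asymptotics.IsBigO.fun_sum fun k _ =>
    (intervalIntegral_pow_mul_exp_isBigO k hs _).const_mul_left _)
  set D := C * (π / 2) ^ (2 * R) / Real.cos a
  refine Asymptotics.IsBigO.of_bound (D * (Real.Gamma (R + 1 / 2) / 2)) ?_
  filter_upwards [eventually_gt_atTop 0] with μ hμ
  have hbound (u : ℝ) (hu : u ∈ Set.Icc 0 a) :
      |cosRemainder ν R u| ≤ D * (Real.cos u * Real.sin u ^ (2 * R)) := by
    have h1 : u ≤ π / 2 * Real.sin u := by
      have := Real.mul_le_sin hu.1 (by linarith [hu.2])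
      calc u = π / 2 * (2 / π * u) := by field_simp
        _ ≤ _ := by gcongr
    have h2 : 1 ≤ Real.cos u / Real.cos a := by
      rw [one_le_div hca]
      exact Real.cos_le_cos_of_nonneg_of_le_pi hu.1 (by linarith) hu.2
    calc _ ≤ C * u ^ (2 * R) := by simpa [abs_of_nonneg hu.1] using hC u
      _ ≤ C * (π / 2 * Real.sin u) ^ (2 * R) * (Real.cos u / Real.cos a) := by
        have := hu.1
        refine le_trans ?_ (le_mul_of_one_le_right
          (mul_nonneg hC0 ((even_two_mul R).pow_nonneg _)) h2)
        gcongr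
      _ = _ := by rw [mul_pow]; ring
  have hD0 : 0 ≤ D := by positivity
  rw [Real.norm_of_nonneg (Real.rpow_nonneg hμ.le _), mul_assoc]
  calc _ ≤ ∫ u in (0 : ℝ)..a, D * (Real.cos u * Real.sin u ^ (2 * R) *
        Real.exp (-μ * Real.sin u ^ 2)) := by
        refine intervalIntegral.norm_integral_le_of_norm_le ha.le
          (Eventually.of_forall fun u hu => ?_)
          (Continuous.intervalIntegrable (by fun_prop) _ _)
        rw [norm_mul, Real.norm_of_nonneg (Real.exp_nonneg _), ← mul_assoc]
        exact mul_le_mul_of_nonneg_right (hbound u ⟨hu.1.le, hu.2⟩) (Real.exp_nonneg _)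
    _ = D * ∫ t in (0 : ℝ)..Real.sin a, t ^ (2 * R) * Real.exp (-μ * t ^ 2) := by
        rw [intervalIntegral.integral_const_mul, integral_cos_mul_sin_pow_mul_exp]
    _ ≤ _ := by
        gcongr
        exact intervalIntegral_pow_mul_exp_le R hμ hs.le

/-- The normalized integrand `w ^ A * exp (l * (w + 1 / w))`, with saddle point `w = 1`. -/
noncomputable def saddleKernel (A l : ℝ) (w : ℂ) : ℂ :=
  w ^ (A : ℂ) * Complex.exp (l * (w + 1 / w))

lemma mem_ball_iff_normSq_lt {M : ℝ} (hM : 0 ≤ M) {w : ℂ} :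
    w ∈ Metric.ball (M : ℂ) M ↔ Complex.normSq w < 2 * M * w.re := by
  rw [Metric.mem_ball, Complex.dist_eq, ← sq_lt_sq₀ (norm_nonneg _) hM, Complex.sq_norm,
    Complex.normSq_apply, Complex.normSq_apply]
  simp only [Complex.sub_re, Complex.sub_im, Complex.ofReal_re, Complex.ofReal_im]
  constructor <;> intro h <;> nlinarith

lemma re_pos_of_mem_ball {M : ℝ} (hM : 0 < M) {w : ℂ} (hw : w ∈ Metric.ball (M : ℂ) M) :
    0 < w.re := by
  rw [mem_ball_iff_normSq_lt hM.le] at hw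
  have := (Complex.normSq_nonneg w).trans_lt hw
  exact pos_of_mul_pos_right this (by positivity)

lemma differentiableOn_saddleKernel (A l : ℝ) {M : ℝ} (hM : 0 < M) :
    DifferentiableOn ℂ (saddleKernel A l) (Metric.ball (M : ℂ) M) := by
  intro w hw
  have hslit : w ∈ Complex.slitPlane := Or.inl (re_pos_of_mem_ball hM hw)
  have h0 := Complex.slitPlane_ne_zero hslit
  unfold saddleKernel
  refine DifferentiableAt.differentiableWithinAt (DifferentiableAt.mul ?_ ?_)
  · exact differentiableAt_id.cpow_const hslit
  · fun_prop (disch := assumption)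

lemma norm_saddleKernel (A l : ℝ) (w : ℂ) :
    ‖saddleKernel A l w‖ = ‖w‖ ^ A * Real.exp (l * (w.re + w.re / Complex.normSq w)) := by
  rw [saddleKernel, norm_mul, Complex.norm_cpow_real, Complex.norm_exp]
  simp

lemma saddleKernel_exp_mul_I (A l : ℝ) {x : ℝ} (hx : |x| < π) :
    saddleKernel A l (Complex.exp (x * Complex.I)) =
      Complex.exp (A * x * Complex.I) * Complex.exp (2 * l * Real.cos x) := by
  have hx' := abs_lt.1 hx
  rw [saddleKernel, Complex.cpow_def_of_ne_zero (Complex.exp_ne_zero _),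
    Complex.log_exp (by simpa using hx'.1) (by simpa using hx'.2.le), one_div, ← Complex.exp_neg,
    Complex.ofReal_cos, Complex.cos]
  congr 2
  · ring
  · rw [neg_mul]; ring

lemma norm_primitive_sub_le {A l M r x : ℝ} (hA : 0 ≤ A) (hl : 0 ≤ l) (hM : 0 < M)
    (hr : 1 ≤ r) (hrx : r * Real.cos x ≤ 1) (hc : 0 < Real.cos x) (hrM : r < 2 * M * Real.cos x)
    {G : ℂ → ℂ} (hG : ∀ w ∈ Metric.ball (M : ℂ) M, HasDerivAt G (saddleKernel A l w) w) :
    ‖G (r * Complex.exp (x * Complex.I)) - G (Complex.exp (x * Complex.I))‖ ≤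
      r ^ A * Real.exp (l * (1 + Real.cos x)) * (r - 1) := by
  set e := Complex.exp (x * Complex.I)
  have hnorm : ‖e‖ = 1 := Complex.norm_exp_ofReal_mul_I x
  have hre : e.re = Real.cos x := Complex.exp_ofReal_mul_I_re x
  have hsq (ρ : ℝ) : Complex.normSq (ρ * e) = ρ ^ 2 := by
    rw [Complex.normSq_eq_norm_sq, norm_mul, hnorm, mul_one, Complex.norm_real, Real.norm_eq_abs,
      sq_abs]
  have hre' (ρ : ℝ) : ((ρ : ℂ) * e).re = ρ * Real.cos x := by rw [Complex.re_ofReal_mul, hre]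
  have := (convex_Icc 1 r).norm_image_sub_le_of_norm_hasDerivWithin_le
    (f := fun ρ : ℝ => G (ρ * e)) (f' := fun ρ => saddleKernel A l (ρ * e) * e)
    (C := r ^ A * Real.exp (l * (1 + Real.cos x))) (x := 1) (y := r) ?_ ?_
    (by simpa using hr) (by simpa using hr)
  · simpa [abs_of_nonneg (sub_nonneg.2 hr)] using this
  · intro ρ hρ
    have hmem : (ρ : ℂ) * e ∈ Metric.ball (M : ℂ) M := by
      rw [mem_ball_iff_normSq_lt hM.le, hsq, hre']
      nlinarith [hρ.1, hρ.2]
    have h1 : HasDerivAt (fun ρ : ℝ => (ρ : ℂ) * e) e ρ := by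
      simpa using (Complex.ofRealCLM.hasDerivAt (x := ρ)).mul_const e
    exact ((hG _ hmem).comp ρ h1).hasDerivWithinAt
  · intro ρ hρ
    have hρ0 : 0 < ρ := by linarith [hρ.1]
    rw [norm_mul, hnorm, mul_one, norm_saddleKernel, norm_mul, hnorm, mul_one, Complex.norm_real,
      Real.norm_of_nonneg hρ0.le, hsq, hre']
    have h1 : ρ * Real.cos x ≤ 1 := le_trans (by gcongr; exact hρ.2) hrx
    have h2 : ρ * Real.cos x / ρ ^ 2 ≤ Real.cos x := by
      rw [div_le_iff₀ (by positivity)]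
      nlinarith [hρ.1, mul_pos hρ0 hc]
    have := hρ.2
    gcongr

lemma norm_integral_line_sub_integral_arc_le {A θ : ℝ} (hA : 0 ≤ A) (hθ : 0 < θ) :
    ∃ C, ∀ l : ℝ, 0 ≤ l →
      ‖(∫ y in (-θ)..θ, saddleKernel A l (1 + y * Complex.I)) -
        ∫ x in (-Real.arctan θ)..Real.arctan θ,
          Complex.exp ((A + 1 : ℝ) * x * Complex.I) * Complex.exp (2 * l * Real.cos x)‖ ≤
      C * Real.exp (l * (1 + Real.cos (Real.arctan θ))) := by
  set α := Real.arctan θ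
  set r := √(1 + θ ^ 2)
  set M := 1 + θ ^ 2
  have hM : 0 < M := by positivity
  have hrsq : r ^ 2 = M := Real.sq_sqrt hM.le
  have hr0 : 0 < r := Real.sqrt_pos.2 hM
  have hr1 : 1 ≤ r := Real.one_le_sqrt.2 (by nlinarith)
  have hcos : Real.cos α = 1 / r := Real.cos_arctan θ
  have hsin : Real.sin α = θ / r := Real.sin_arctan θ
  have hc0 : 0 < Real.cos α := by rw [hcos]; positivity
  have hrc : r * Real.cos α = 1 := by rw [hcos]; field_simp
  have hrM : r < 2 * M * Real.cos α := by
    rw [← hrsq, hcos, show 2 * r ^ 2 * (1 / r) = 2 * r by field_simp]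
    linarith
  have hα0 : 0 < α := Real.arctan_pos.2 hθ
  have hα2 : α < π / 2 := Real.arctan_lt_pi_div_two θ
  have hup : (r : ℂ) * Complex.exp (α * Complex.I) = 1 + θ * Complex.I := by
    apply Complex.ext <;> simp [Complex.exp_ofReal_mul_I_re, Complex.exp_ofReal_mul_I_im, hcos,
      hsin] <;> field_simp
  have hdown : (r : ℂ) * Complex.exp ((-α : ℝ) * Complex.I) = 1 + (-θ : ℝ) * Complex.I := by
    apply Complex.ext
    · rw [Complex.re_ofReal_mul, Complex.exp_ofReal_mul_I_re, Real.cos_neg, hcos]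
      simp
      field_simp
    · rw [Complex.im_ofReal_mul, Complex.exp_ofReal_mul_I_im, Real.sin_neg, hsin]
      simp
      field_simp
  refine ⟨2 * (r ^ A * (r - 1)), fun l hl => ?_⟩
  have hdiff := differentiableOn_saddleKernel A l hM
  obtain ⟨G, hG⟩ := hdiff.isExactOn_ball
  have hline (y : ℝ) (hy : y ∈ Set.uIcc (-θ) θ) :
      1 + y * Complex.I ∈ Metric.ball (M : ℂ) M := by
    rw [Set.uIcc_of_le (by linarith)] at hy
    rw [mem_ball_iff_normSq_lt hM.le, Complex.normSq_apply]
    simp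
    nlinarith [hy.1, hy.2]
  have harc (x : ℝ) (hx : x ∈ Set.uIcc (-α) α) :
      Complex.exp (x * Complex.I) ∈ Metric.ball (M : ℂ) M := by
    rw [Set.uIcc_of_le (by linarith)] at hx
    rw [mem_ball_iff_normSq_lt hM.le, Complex.normSq_eq_norm_sq, Complex.norm_exp_ofReal_mul_I,
      Complex.exp_ofReal_mul_I_re]
    have : Real.cos α ≤ Real.cos x := by
      rw [← Real.cos_abs x]
      exact Real.cos_le_cos_of_nonneg_of_le_pi (abs_nonneg _) (by linarith) (abs_le.2 hx)
    nlinarith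
  have hI1 : (∫ y in (-θ)..θ, saddleKernel A l (1 + y * Complex.I)) * Complex.I =
      G (1 + θ * Complex.I) - G (1 + (-θ : ℝ) * Complex.I) := by
    rw [← intervalIntegral.integral_mul_const]
    refine intervalIntegral.integral_eq_sub_of_hasDerivAt
      (f := fun y : ℝ => G (1 + y * Complex.I)) (fun y hy => ?_) ?_
    · have h1 : HasDerivAt (fun y : ℝ => 1 + (y : ℂ) * Complex.I) Complex.I y := by
        simpa using ((Complex.ofRealCLM.hasDerivAt (x := y)).mul_const Complex.I).const_add 1
      exact (hG _ (hline y hy)).comp y h1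
    · refine ContinuousOn.intervalIntegrable (ContinuousOn.mul ?_ continuousOn_const)
      exact hdiff.continuousOn.comp (by fun_prop) hline
  have hI2 : (∫ x in (-α)..α, Complex.exp ((A + 1 : ℝ) * x * Complex.I) *
        Complex.exp (2 * l * Real.cos x)) * Complex.I =
      G (Complex.exp (α * Complex.I)) - G (Complex.exp ((-α : ℝ) * Complex.I)) := by
    rw [← intervalIntegral.integral_mul_const]
    refine intervalIntegral.integral_eq_sub_of_hasDerivAt
      (f := fun x : ℝ => G (Complex.exp (x * Complex.I))) (fun x hx => ?_) ?_
    · have h1 : HasDerivAt (fun x : ℝ => Complex.exp ((x : ℂ) * Complex.I))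
          (Complex.exp (x * Complex.I) * Complex.I) x := by
        simpa using ((Complex.ofRealCLM.hasDerivAt (x := x)).mul_const Complex.I).cexp
      refine ((hG _ (harc x hx)).comp x h1).congr_deriv ?_
      rw [Set.uIcc_of_le (by linarith)] at hx
      rw [saddleKernel_exp_mul_I A l ((abs_le.2 hx).trans_lt (by linarith)),
        show (((A + 1 : ℝ) : ℂ) * x * Complex.I) = A * x * Complex.I + x * Complex.I by
          push_cast; ring, Complex.exp_add]
      ring
    · exact Continuous.intervalIntegrable (by fun_prop) _ _
  have hb1 := norm_primitive_sub_le hA hl hM hr1 hrc.le hc0 hrM hG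
  have hb2 := norm_primitive_sub_le (x := -α) hA hl hM hr1 (by rw [Real.cos_neg]; exact hrc.le)
    (by rwa [Real.cos_neg]) (by rwa [Real.cos_neg]) hG
  rw [hup] at hb1
  rw [hdown, Real.cos_neg] at hb2
  have hmul_I (z : ℂ) : ‖z‖ = ‖z * Complex.I‖ := by simp
  rw [hmul_I, sub_mul, hI1, hI2, sub_sub_sub_comm]
  refine (norm_sub_le _ _).trans ((add_le_add hb1 hb2).trans_eq ?_)
  ring

lemma integral_arc_eq (ν l a : ℝ) :
    ∫ x in (-(2 * a))..(2 * a),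
        Complex.exp (ν * x * Complex.I) * Complex.exp (2 * l * Real.cos x) =
      ((4 * Real.exp (2 * l) * ∫ u in (0 : ℝ)..a,
        Real.cos (2 * ν * u) * Real.exp (-(4 * l) * Real.sin u ^ 2) : ℝ) : ℂ) := by
  set f : ℝ → ℂ := fun x =>
    Complex.exp (ν * x * Complex.I) * Complex.exp (2 * l * Real.cos x) with hf
  have hfc : Continuous f := by fun_prop
  have hfc' : Continuous fun x => f (-x) := by fun_prop
  have h1 : ∫ x in (-(2 * a))..0, f x = ∫ x in (0 : ℝ)..(2 * a), f (-x) := by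
    simp
  have h2 : ∫ x in (0 : ℝ)..(2 * a), f (-x) + f x =
      (2 : ℝ) • ∫ u in (0 : ℝ)..a, f (-(2 * u)) + f (2 * u) := by
    have := intervalIntegral.integral_comp_mul_left (a := 0) (b := a) (fun x => f (-x) + f x)
      (two_ne_zero (α := ℝ))
    rw [this, smul_smul, mul_inv_cancel₀ two_ne_zero, one_smul, mul_zero]
  rw [← intervalIntegral.integral_add_adjacent_intervals (b := 0) (hfc.intervalIntegrable _ _)
    (hfc.intervalIntegrable _ _), h1, ← intervalIntegral.integral_add
    (hfc'.intervalIntegrable _ _) (hfc.intervalIntegrable _ _), h2,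
    Complex.ofReal_mul, ← intervalIntegral.integral_ofReal, Complex.real_smul,
    ← intervalIntegral.integral_const_mul, ← intervalIntegral.integral_const_mul]
  refine intervalIntegral.integral_congr fun u _ => ?_
  have hcos : 2 * l * Real.cos (2 * u) = 2 * l + -(4 * l) * Real.sin u ^ 2 := by
    rw [Real.cos_two_mul, Real.cos_sq']; ring
  have hsum : Complex.exp (ν * ((-(2 * u) : ℝ) : ℂ) * Complex.I) +
      Complex.exp (ν * ((2 * u : ℝ) : ℂ) * Complex.I) = 2 * (Real.cos (2 * ν * u) : ℂ) := by
    rw [Complex.ofReal_cos, Complex.cos, add_comm]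
    push_cast
    rw [mul_div_cancel₀ _ two_ne_zero]
    congr 2 <;> ring
  have hexp : Complex.exp (2 * l * Real.cos (2 * u)) =
      Real.exp (2 * l) * Real.exp (-(4 * l) * Real.sin u ^ 2) := by
    rw [← Complex.ofReal_mul, ← Real.exp_add, ← hcos]
    push_cast
    rfl
  simp only [hf, Real.cos_neg]
  rw [← add_mul, hsum, hexp]
  push_cast
  ring

lemma integral_line_isBigO {A θ : ℝ} (hA : 0 ≤ A) (hθ : 0 < θ) (R : ℕ) :
    (fun l : ℝ => (Real.exp (-(2 * l)) : ℂ) *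
        (∫ y in (-θ)..θ, saddleKernel A l (1 + y * Complex.I)) -
      ((∑ k ∈ Finset.range R, cosCoeff (A + 1) k *
        (2 * Real.Gamma (k + 1 / 2) * (4 * l) ^ (-((k : ℝ) + 1 / 2))) : ℝ) : ℂ)) =O[atTop]
      fun l : ℝ => l ^ (-((R : ℝ) + 1 / 2)) := by
  obtain ⟨C, hC⟩ := norm_integral_line_sub_integral_arc_le hA hθ
  set α := Real.arctan θ
  have hα0 : 0 < α := Real.arctan_pos.2 hθ
  have hα2 : α < π / 2 := Real.arctan_lt_pi_div_two θ
  have hcos : Real.cos α < 1 := by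
    have := Real.cos_lt_cos_of_nonneg_of_le_pi le_rfl (by linarith) hα0
    rwa [Real.cos_zero] at this
  set arc : ℝ → ℂ := fun l => ∫ x in (-α)..α,
    Complex.exp ((A + 1 : ℝ) * x * Complex.I) * Complex.exp (2 * l * Real.cos x)
  have herr : (fun l : ℝ => (Real.exp (-(2 * l)) : ℂ) *
      ((∫ y in (-θ)..θ, saddleKernel A l (1 + y * Complex.I)) - arc l)) =O[atTop]
      fun l : ℝ => l ^ (-((R : ℝ) + 1 / 2)) := by
    refine Asymptotics.IsBigO.trans (Asymptotics.IsBigO.of_bound C ?_)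
      (isBigO_exp_neg_mul_rpow (c := 1 - Real.cos α) (by linarith) _)
    filter_upwards [eventually_ge_atTop 0] with l hl
    rw [norm_mul, Complex.norm_real, Real.norm_of_nonneg (Real.exp_nonneg _),
      Real.norm_of_nonneg (Real.exp_nonneg _)]
    refine (mul_le_mul_of_nonneg_left (hC l hl) (Real.exp_nonneg _)).trans_eq ?_
    rw [mul_left_comm, ← Real.exp_add]
    congr 2
    ring
  have hlap := (integral_cos_mul_exp_neg_sin_sq_isBigO (A + 1) (half_pos hα0) (by linarith)
    R).comp_tendsto (tendsto_id.const_mul_atTop (four_pos : (0 : ℝ) < 4))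
  have hscale : ((fun μ : ℝ => μ ^ (-((R : ℝ) + 1 / 2))) ∘ fun l => 4 * id l) =O[atTop]
      fun l : ℝ => l ^ (-((R : ℝ) + 1 / 2)) := by
    refine Asymptotics.IsBigO.of_bound ‖(4 : ℝ) ^ (-((R : ℝ) + 1 / 2))‖ ?_
    filter_upwards [eventually_ge_atTop 0] with l hl
    rw [Function.comp_apply, id, Real.mul_rpow four_pos.le hl, norm_mul]
  have hmain := (Complex.isBigO_ofReal_left.2 (hlap.trans hscale)).const_mul_left 4
  refine (herr.add hmain).congr_left fun l => ?_
  have harc_eq := integral_arc_eq (A + 1) l (α / 2)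
  rw [mul_div_cancel₀ _ two_ne_zero] at harc_eq
  change arc l = _ at harc_eq
  have hexp : (Real.exp (-(2 * l)) : ℂ) * Real.exp (2 * l) = 1 := by
    rw [← Complex.ofReal_mul, ← Real.exp_add]; simp
  have hsum : ∑ k ∈ Finset.range R, cosCoeff (A + 1) k *
        (2 * Real.Gamma (k + 1 / 2) * (4 * l) ^ (-((k : ℝ) + 1 / 2))) =
      4 * ∑ k ∈ Finset.range R, cosCoeff (A + 1) k *
        (Real.Gamma (k + 1 / 2) / 2 * (4 * l) ^ (-((k : ℝ) + 1 / 2))) := by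
    rw [Finset.mul_sum]
    exact Finset.sum_congr rfl fun k _ => by ring
  rw [harc_eq, hsum]
  simp only [Function.comp_apply, id]
  rw [Complex.ofReal_mul, Complex.ofReal_mul, Complex.ofReal_mul, Complex.ofReal_sub,
    Complex.ofReal_ofNat]
  linear_combination (-4 * ((∫ u in (0 : ℝ)..(α / 2), Real.cos (2 * (A + 1) * u) *
    Real.exp (-(4 * l) * Real.sin u ^ 2) : ℝ) : ℂ)) * hexp

lemma cosCoeff_mul_Gamma {ν : ℝ} (hν : 0 ≤ ν) (k : ℕ) :
    cosCoeff ν k * Real.Gamma (k + 1 / 2) =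
      √π * (-1) ^ k * Real.Gamma (ν + k + 1 / 2) /
        (k.factorial * Real.Gamma (ν - k + 1 / 2)) := by
  induction k with
  | zero =>
    have : Real.Gamma (ν + 1 / 2) ≠ 0 := (Real.Gamma_pos_of_pos (by positivity)).ne'
    simp only [cosCoeff, Nat.cast_zero, zero_add, add_zero, sub_zero, pow_zero, Nat.factorial_zero,
      Nat.cast_one, one_mul, mul_one]
    rw [Real.Gamma_one_half_eq, mul_div_assoc, div_self this, mul_one]
  | succ k ih =>
    have h1 : Real.Gamma (((k + 1 : ℕ) : ℝ) + 1 / 2) = (k + 1 / 2) * Real.Gamma (k + 1 / 2) := by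
      rw [← Real.Gamma_add_one (by positivity)]
      congr 1
      push_cast
      ring
    have h2 : Real.Gamma (ν + (k + 1 : ℕ) + 1 / 2) =
        (ν + k + 1 / 2) * Real.Gamma (ν + k + 1 / 2) := by
      rw [← Real.Gamma_add_one (by positivity)]
      congr 1
      push_cast
      ring
    have h3 : (Real.Gamma (ν - (k + 1 : ℕ) + 1 / 2))⁻¹ =
        (ν - k - 1 / 2) * (Real.Gamma (ν - k + 1 / 2))⁻¹ := by
      rw [show ν - (k + 1 : ℕ) + 1 / 2 = ν - k - 1 / 2 by push_cast; ring,
        show ν - k + 1 / 2 = ν - k - 1 / 2 + 1 by ring]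
      rcases eq_or_ne (ν - k - 1 / 2) 0 with h | h
      · rw [h]; simp
      · rw [Real.Gamma_add_one h, mul_inv, mul_inv_cancel_left₀ h]
    have hf : (((k + 1).factorial : ℕ) : ℝ) = (k + 1) * k.factorial := by
      push_cast [Nat.factorial_succ]; ring
    have hdiv (a b c : ℝ) : a / (b * c) = a * b⁻¹ * c⁻¹ := by
      rw [div_eq_mul_inv, mul_inv, mul_assoc]
    rw [hdiv] at ih ⊢
    rw [h1, h2, h3, hf, cosCoeff, pow_succ]
    calc _ = (cosCoeff ν k * Real.Gamma (k + 1 / 2)) *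
          (((2 * k + 1) ^ 2 - 4 * ν ^ 2) / (4 * (k + 1))) := by field_simp; ring
      _ = _ := by rw [ih]; field_simp; ring

lemma rpow_saddle_scaling {A B x : ℝ} (hB : 0 < B) (hx : 0 < x) (r : ℕ) :
    (B / √x) ^ (A + 1) * (4 * (B * √x)) ^ (-((r : ℝ) + 1 / 2)) =
      (4 * B) ^ (-(r : ℤ)) * B ^ (A + 1 / 2) / 2 * x ^ ((-2 * A - 3) / 4) *
        x ^ (-(r : ℝ) / 2) := by
  have hsx : 0 < √x := Real.sqrt_pos.2 hx
  have h4 : Real.log 4 = 2 * Real.log 2 := by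
    rw [show (4 : ℝ) = 2 ^ 2 by norm_num, Real.log_pow]; norm_num
  have hz : (4 * B) ^ (-(r : ℤ)) = (4 * B) ^ (-(r : ℝ)) := by
    rw [← Real.rpow_intCast]; simp
  have hrhs : (4 * B) ^ (-(r : ℤ)) * B ^ (A + 1 / 2) / 2 * x ^ ((-2 * A - 3) / 4) *
      x ^ (-(r : ℝ) / 2) = (4 * B) ^ (-(r : ℝ)) * B ^ (A + 1 / 2) * Real.exp (-Real.log 2) *
        x ^ ((-2 * A - 3) / 4) * x ^ (-(r : ℝ) / 2) := by
    rw [hz, Real.exp_neg, Real.exp_log two_pos]; ring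
  rw [hrhs, Real.rpow_def_of_pos (by positivity), Real.rpow_def_of_pos (by positivity),
    Real.rpow_def_of_pos (by positivity), Real.rpow_def_of_pos hB, Real.rpow_def_of_pos hx,
    Real.rpow_def_of_pos hx, Real.log_div hB.ne' hsx.ne', Real.log_mul four_ne_zero (by positivity),
    Real.log_mul hB.ne' hsx.ne', Real.log_mul four_ne_zero hB.ne', Real.log_sqrt hx.le, h4]
  simp only [← Real.exp_add]
  congr 1
  ring

lemma saddleIntegral_eq (A : ℝ) {B : ℝ} (hB : 0 < B) (θ : ℝ) {n : ℕ} (hn : 0 < n) :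
    saddleIntegral A B θ n = (((B / √n) ^ (A + 1) / (2 * π) : ℝ) : ℂ) *
      ∫ y in (-θ)..θ, saddleKernel A (B * √n) (1 + y * Complex.I) := by
  have hs : 0 < √(n : ℝ) := Real.sqrt_pos.2 (by exact_mod_cast hn)
  have hη : 0 < B / √n := by positivity
  have hne (y : ℝ) : (1 + y * Complex.I : ℂ) ≠ 0 := fun h => by
    simpa using congrArg Complex.re h
  rw [saddleIntegral]
  refine Eq.trans (congrArg _ (intervalIntegral.integral_congr
    (g := fun y : ℝ => (((B / √n) ^ A : ℝ) : ℂ) * saddleKernel A (B * √n) (1 + y * Complex.I))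
    fun y _ => ?_)) ?_
  swap
  · rw [intervalIntegral.integral_const_mul, Real.rpow_add_one hη.ne']
    push_cast
    ring
  have hpow : (((B / √n : ℝ) : ℂ) * (1 + y * Complex.I)) ^ (A : ℂ) =
      ((B / √n) ^ A : ℝ) * (1 + y * Complex.I) ^ (A : ℂ) := by
    rw [Complex.cpow_def_of_ne_zero (mul_ne_zero (by exact_mod_cast hη.ne') (hne y)),
      Complex.cpow_def_of_ne_zero (hne y), Complex.log_ofReal_mul hη (hne y),
      Real.rpow_def_of_pos hη, add_mul, Complex.exp_add]
    push_cast
    rfl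
  simp only
  rw [hpow, saddleKernel, mul_assoc]
  congr 3
  have hsC : ((√(n : ℝ) : ℝ) : ℂ) ≠ 0 := by exact_mod_cast hs.ne'
  have hBC : (B : ℂ) ≠ 0 := by exact_mod_cast hB.ne'
  have hsq : (n : ℂ) = ((√(n : ℝ) : ℝ) : ℂ) ^ 2 := by
    rw [← Complex.ofReal_pow, Real.sq_sqrt n.cast_nonneg]; simp
  rw [hsq]
  have := hne y
  push_cast
  field_simp
  ring

lemma saddle_term_eq {A B x : ℝ} (hA : 0 ≤ A) (hB : 0 < B) (hx : 0 < x) (r : ℕ) :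
    (B / √x) ^ (A + 1) / (2 * π) * (cosCoeff (A + 1) r *
        (2 * Real.Gamma (r + 1 / 2) * (4 * (B * √x)) ^ (-((r : ℝ) + 1 / 2)))) =
      x ^ ((-2 * A - 3) / 4) * (Tcoef A B r * x ^ (-(r : ℝ) / 2)) := by
  have hπ : √π * √π = π := Real.mul_self_sqrt pi_pos.le
  have hsπ : √π ≠ 0 := (Real.sqrt_pos.2 pi_pos).ne'
  have hsign : (-4 * B) ^ (-(r : ℤ)) = (-1) ^ r * (4 * B) ^ (-(r : ℤ)) := by
    rw [show -4 * B = -1 * (4 * B) by ring, mul_zpow]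
    simp [← inv_pow]
  calc _ = (cosCoeff (A + 1) r * Real.Gamma (r + 1 / 2)) / π *
        ((B / √x) ^ (A + 1) * (4 * (B * √x)) ^ (-((r : ℝ) + 1 / 2))) := by
        field_simp
    _ = _ := by
        rw [cosCoeff_mul_Gamma (by positivity), rpow_saddle_scaling hB hx, Tcoef, hsign,
          show A + 1 + r + 1 / 2 = A + r + 3 / 2 by ring,
          show A + 1 - r + 1 / 2 = A - r + 3 / 2 by ring]
        nth_rewrite 2 [← hπ]
        simp only [div_eq_mul_inv, mul_inv]
        field_simp

/-- Saddle point lemma: for A ≥ 0, B > 0, θ > 0 and every R ∈ ℕ, as n → ∞,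
(1/2πi)∫_{C₁(B/√n)} z^A e^{B²/z+nz} dz
  = n^{(-2A-3)/4} e^{2B√n} (Σ_{r=0}^{R-1} T_{A,B,r} n^{-r/2} + O(n^{-R/2})). -/
theorem saddle_point_asymp (A B θ : ℝ) (hA : 0 ≤ A) (hB : 0 < B) (hθ : 0 < θ) (R : ℕ) :
    (fun n : ℕ => saddleIntegral A B θ n -
        (((n : ℝ) ^ ((-2 * A - 3) / 4) * Real.exp (2 * B * Real.sqrt n) *
          ∑ r ∈ Finset.range R, Tcoef A B r * (n : ℝ) ^ (-(r : ℝ) / 2) : ℝ) : ℂ)) =O[atTop]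
      (fun n : ℕ => (n : ℝ) ^ ((-2 * A - 3) / 4) * Real.exp (2 * B * Real.sqrt n) *
        (n : ℝ) ^ (-(R : ℝ) / 2)) := by
  have hlim : Tendsto (fun n : ℕ => B * √(n : ℝ)) atTop atTop :=
    (Real.tendsto_sqrt_atTop.comp tendsto_natCast_atTop_atTop).const_mul_atTop hB
  obtain ⟨C, hC⟩ := ((integral_line_isBigO hA hθ R).comp_tendsto hlim).bound
  refine Asymptotics.IsBigO.of_bound
    (C * ((4 : ℝ) ^ ((R : ℝ) + 1 / 2) * ((4 * B) ^ (-(R : ℤ)) * B ^ (A + 1 / 2) / 2) / (2 * π))) ?_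
  filter_upwards [hC, eventually_gt_atTop 0] with n hn hn0
  have hx : (0 : ℝ) < n := by exact_mod_cast hn0
  simp only [Function.comp_apply] at hn
  set l := B * √(n : ℝ) with hl
  have hl0 : 0 < l := by positivity
  set K := ∫ y in (-θ)..θ, saddleKernel A l (1 + y * Complex.I)
  set P := (B / √(n : ℝ)) ^ (A + 1) / (2 * π) with hP
  have hP0 : 0 < P := by positivity
  set S := ∑ k ∈ Finset.range R, cosCoeff (A + 1) k *
    (2 * Real.Gamma (k + 1 / 2) * (4 * l) ^ (-((k : ℝ) + 1 / 2))) with hS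
  have hsum : (n : ℝ) ^ ((-2 * A - 3) / 4) * Real.exp (2 * B * √(n : ℝ)) *
      ∑ r ∈ Finset.range R, Tcoef A B r * (n : ℝ) ^ (-(r : ℝ) / 2) =
      P * Real.exp (2 * l) * S := by
    rw [show 2 * B * √(n : ℝ) = 2 * l by rw [hl]; ring, mul_right_comm, mul_right_comm P, hS,
      Finset.mul_sum, Finset.mul_sum]
    congr 1
    exact Finset.sum_congr rfl fun r _ => (saddle_term_eq hA hB hx r).symm
  have hexp : (Real.exp (2 * l) : ℂ) * Real.exp (-(2 * l)) = 1 := by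
    rw [← Complex.ofReal_mul, ← Real.exp_add]; simp
  have hfactor : saddleIntegral A B θ n - ((P * Real.exp (2 * l) * S : ℝ) : ℂ) =
      ((P * Real.exp (2 * l) : ℝ) : ℂ) * ((Real.exp (-(2 * l)) : ℂ) * K - (S : ℂ)) := by
    rw [saddleIntegral_eq A hB θ hn0]
    rw [Complex.ofReal_mul, Complex.ofReal_mul]
    linear_combination (-(P : ℂ) * K) * hexp
  have hscale : P * l ^ (-((R : ℝ) + 1 / 2)) =
      (4 : ℝ) ^ ((R : ℝ) + 1 / 2) * ((4 * B) ^ (-(R : ℤ)) * B ^ (A + 1 / 2) / 2) / (2 * π) *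
        ((n : ℝ) ^ ((-2 * A - 3) / 4) * (n : ℝ) ^ (-(R : ℝ) / 2)) := by
    have h := rpow_saddle_scaling (A := A) hB hx R
    have h4 : (4 : ℝ) ^ ((R : ℝ) + 1 / 2) * (4 : ℝ) ^ (-((R : ℝ) + 1 / 2)) = 1 := by
      rw [← Real.rpow_add four_pos]; simp
    rw [← hl, Real.mul_rpow four_pos.le hl0.le] at h
    rw [hP]
    linear_combination (4 : ℝ) ^ ((R : ℝ) + 1 / 2) / (2 * π) * h -
      (B / √(n : ℝ)) ^ (A + 1) / (2 * π) * l ^ (-((R : ℝ) + 1 / 2)) * h4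
  rw [hsum, hfactor, norm_mul, Complex.norm_real, Real.norm_of_nonneg (by positivity),
    Real.norm_of_nonneg (by positivity)]
  rw [Real.norm_of_nonneg (Real.rpow_nonneg hl0.le _)] at hn
  refine (mul_le_mul_of_nonneg_left hn (by positivity)).trans_eq ?_
  rw [show 2 * B * √(n : ℝ) = 2 * l by rw [hl]; ring]
  linear_combination (C * Real.exp (2 * l)) * hscale
end
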